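/- Let F : ℂ³ → ℂ² be the polynomial map F(x,y,z) = (x, [(x−1)(xz+y²)+1]·[x(xz+y²)−1]). There is an open neighborhood U of (0,0) in ℂ² such that for every t ∈ U the fibre F^{-1}(t) is diffeomorphic to the disjoint union ℂ ⊔ ℂ of two copies of ℂ (in particular b_0(t) = 2 and b_1(t) = 0 are constant on U), and yet F is not a locally trivial fibration over any neighborhood of (0,0): for no open neighborhood D of (0,0) does there exist a homeomorphism Φ : F^{-1}(D) → D × F^{-1}(0,0) with pr_1 ∘ Φ = F. In particular (0,0) is a bifurcation value of F although the Betti numbers of the fibres are constant near (0,0). -/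

import Mathlib

open Filter Set Topology

noncomputable section

/-- The singular chain complex of a topological space, with `ℚ` coefficients:
the alternating face map complex of the free simplicial `ℚ`-module on the
singular simplicial set. -/
def singularChainComplex (X : Type) [TopologicalSpace X] : ChainComplex (ModuleCat ℚ) ℕ :=
  (AlgebraicTopology.alternatingFaceMapComplex (ModuleCat ℚ)).obj
    (((CategoryTheory.SimplicialObject.whiskering (Type) (ModuleCat ℚ)).obj
      (ModuleCat.free ℚ)).obj (TopCat.toSSet.obj (TopCat.of X)))

/-- Singular homology of a topological space with `ℚ` coefficients. -/
def singularHomology (X : Type) [TopologicalSpace X] (i : ℕ) : ModuleCat ℚ :=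
  (singularChainComplex X).homology i

/-- The `i`-th Betti number: the dimension over `ℚ` of the `i`-th singular
homology with `ℚ` coefficients. -/
def bettiNumber (X : Type) [TopologicalSpace X] (i : ℕ) : ℕ :=
  Module.finrank ℚ (singularHomology X i)

/-- The `i`-th Betti number is finite. -/
def FiniteBetti (X : Type) [TopologicalSpace X] (i : ℕ) : Prop :=
  FiniteDimensional ℚ (singularHomology X i)

/-- `Φ` and `Ψ` give mutually inverse smooth maps between `S ⊆ E` and `T ⊆ F`,
i.e. a diffeomorphism between `S` and `T` (smoothness of a map on a subset is
expressed via `ContDiffOn`). -/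
def IsDiffeoOn {E F : Type} [NormedAddCommGroup E] [NormedSpace ℝ E]
    [NormedAddCommGroup F] [NormedSpace ℝ F]
    (Φ : E → F) (Ψ : F → E) (S : Set E) (T : Set F) : Prop :=
  ContDiffOn ℝ (⊤ : ℕ∞) Φ S ∧ ContDiffOn ℝ (⊤ : ℕ∞) Ψ T ∧ Set.MapsTo Φ S T ∧ Set.MapsTo Ψ T S ∧
    Set.LeftInvOn Ψ Φ S ∧ Set.RightInvOn Ψ Φ T

/-- `S` and `T` are diffeomorphic. -/
def DiffeoEquiv {E F : Type} [NormedAddCommGroup E] [NormedSpace ℝ E]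
    [NormedAddCommGroup F] [NormedSpace ℝ F] (S : Set E) (T : Set F) : Prop :=
  ∃ Φ Ψ, IsDiffeoOn Φ Ψ S T

/-- The restriction of `p` to `M` is a trivial smooth fibration over `D` with fibre
`p⁻¹(lam) ∩ M`: there is a diffeomorphism `Φ : M ∩ p⁻¹(D) → D × (M ∩ p⁻¹(lam))`
with `pr₁ ∘ Φ = p`. -/
def IsSmoothTrivialFibrationOn {E F : Type} [NormedAddCommGroup E] [NormedSpace ℝ E]
    [NormedAddCommGroup F] [NormedSpace ℝ F]
    (p : E → F) (M : Set E) (D : Set F) (lam : F) : Prop :=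
  ∃ Φ : E → F × E, ∃ Ψ : F × E → E,
    IsDiffeoOn Φ Ψ (M ∩ p ⁻¹' D) (D ×ˢ (M ∩ p ⁻¹' {lam})) ∧
    ∀ x ∈ M ∩ p ⁻¹' D, (Φ x).1 = p x

/-- `lam` is not a bifurcation value of `p : M → B`. -/
def IsNotBifurcationValueOn {E F : Type} [NormedAddCommGroup E] [NormedSpace ℝ E]
    [NormedAddCommGroup F] [NormedSpace ℝ F]
    (p : E → F) (M : Set E) (B : Set F) (lam : F) : Prop :=
  ∃ D : Set F, IsOpen D ∧ lam ∈ D ∧ D ⊆ B ∧ IsSmoothTrivialFibrationOn p M D lam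

/-- `g : V → ℂᵏ` is a holomorphic local defining function for `M` at `x`, with
surjective derivative at every point of its zero set. -/
def IsLocalDefiningFunction {E : Type} [NormedAddCommGroup E] [NormedSpace ℂ E]
    (k : ℕ) (M : Set E) (x : E) (V : Set E) (g : E → (Fin k → ℂ)) : Prop :=
  IsOpen V ∧ x ∈ V ∧ DifferentiableOn ℂ g V ∧
    (∀ y ∈ V, g y = 0 → Function.Surjective (fderiv ℂ g y)) ∧
    M ∩ V = {y ∈ V | g y = 0}

/-- `M ⊆ ℂᴺ` is a (Stein) closed complex submanifold of complex dimension `m`: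
it is closed and near each of its points it is the zero set of a holomorphic
submersion to `ℂ^{N-m}`. -/
def IsSteinSubmanifold (N m : ℕ) (M : Set (Fin N → ℂ)) : Prop :=
  IsClosed M ∧ ∀ x ∈ M, ∃ V g, IsLocalDefiningFunction (N - m) M x V g

/-- A holomorphic map `p` (defined near `M`) is a submersion at `x ∈ M`: its
derivative maps the tangent space `T_x M = ker (d_x g)` onto the target, where
`g` is a local defining function of `M` near `x` (of codimension `k`). -/
def SubmersionAt {E F : Type} [NormedAddCommGroup E] [NormedSpace ℂ E]
    [NormedAddCommGroup F] [NormedSpace ℂ F]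
    (k : ℕ) (M : Set E) (p : E → F) (x : E) : Prop :=
  ∃ V g, IsLocalDefiningFunction k M x V g ∧
    Submodule.map (fderiv ℂ p x).toLinearMap
      (LinearMap.ker (fderiv ℂ g x).toLinearMap) = ⊤

/-- A connected component of the fibres of `p : M → B` vanishes at infinity as
`t → lam`: there are `t k → lam` in `B` and connected components
`C k = connectedComponentIn (M ∩ p⁻¹(t k)) (x k)` of the fibres over `t k`
which eventually miss every compact subset. -/
def HasVanishingComponentAtInfinity {E F : Type} [TopologicalSpace E] [TopologicalSpace F]
    (M : Set E) (p : E → F) (B : Set F) (lam : F) : Prop :=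
  ∃ t : ℕ → F, ∃ x : ℕ → E,
    (∀ k, t k ∈ B) ∧ Filter.Tendsto t Filter.atTop (nhds lam) ∧
    (∀ k, x k ∈ M ∩ p ⁻¹' {t k}) ∧
    ∀ K : Set E, IsCompact K →
      ∀ᶠ k in Filter.atTop, connectedComponentIn (M ∩ p ⁻¹' {t k}) (x k) ∩ K = ∅

/-- `Φ` and `Ψ` give mutually inverse continuous maps between `S` and `T`,
i.e. a homeomorphism between `S` and `T`. -/
def IsHomeoOn {E F : Type} [TopologicalSpace E] [TopologicalSpace F]
    (Φ : E → F) (Ψ : F → E) (S : Set E) (T : Set F) : Prop :=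
  ContinuousOn Φ S ∧ ContinuousOn Ψ T ∧ Set.MapsTo Φ S T ∧ Set.MapsTo Ψ T S ∧
    Set.LeftInvOn Ψ Φ S ∧ Set.RightInvOn Ψ Φ T

/-- The Euler characteristic `b₀ - b₁` of the fibre of `p : M → ·` over `t`
(the fibres under consideration are open curves, with no homology in degrees ≥ 2). -/
def eulerCharOn {E F : Type} [TopologicalSpace E] (p : E → F) (M : Set E) (t : F) : ℤ :=
  (bettiNumber ↥(M ∩ p ⁻¹' {t}) 0 : ℤ) - (bettiNumber ↥(M ∩ p ⁻¹' {t}) 1 : ℤ)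


def stSingle (T : Type) (t : T) : ModuleCat.of ℚ ℚ ⟶ (ModuleCat.free ℚ).obj T :=
  ModuleCat.ofHom (Finsupp.lsingle t)

open CategoryTheory in
def stFreeIso : (Limits.sigmaConst.{0}.obj (ModuleCat.of ℚ ℚ) : Type ⥤ ModuleCat.{0} ℚ) ≅ ModuleCat.free ℚ :=
  NatIso.ofComponents (fun T =>
    { hom := Limits.Sigma.desc (stSingle T)
      inv := ModuleCat.freeDesc (↾ fun t =>
        (Limits.Sigma.ι (fun _ : T => ModuleCat.of ℚ ℚ) t).hom (1:ℚ))
      hom_inv_id := by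
        apply Limits.Sigma.hom_ext
        intro t
        dsimp only [Limits.sigmaConst_obj_obj]
        rw [Limits.Sigma.ι_desc_assoc]
        apply ModuleCat.hom_ext
        apply LinearMap.ext_ring
        have := ModuleCat.freeDesc_apply (R := ℚ) (M := ∐ fun _ : T => ModuleCat.of ℚ ℚ) (↾ fun t =>
        (Limits.Sigma.ι (fun _ : T => ModuleCat.of ℚ ℚ) t).hom (1:ℚ)) t
        exact this
      inv_hom_id := by
        apply ModuleCat.free_hom_ext
        intro t
        rw [ModuleCat.comp_apply, ModuleCat.freeDesc_apply]
        have := congrArg (fun f => f.hom (1:ℚ)) (Limits.Sigma.ι_desc (f := fun _ : T => ModuleCat.of ℚ ℚ) (P := (ModuleCat.free ℚ).obj T) (stSingle T) t)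
        exact this })
    (by
      intro S T f
      apply Limits.Sigma.hom_ext
      intro s
      dsimp
      rw [Limits.Sigma.ι_comp_map'_assoc, Limits.Sigma.ι_desc_assoc, Limits.Sigma.ι_desc, Category.id_comp]
      apply ModuleCat.hom_ext
      apply LinearMap.ext_ring
      exact (ModuleCat.free_map_apply f s).symm)

open CategoryTheory AlgebraicTopology in
def stChainIso (X : Type) [TopologicalSpace X] :
    singularChainComplex X ≅ ((singularChainComplexFunctor (ModuleCat.{0} ℚ)).obj (ModuleCat.of ℚ ℚ)).obj (TopCat.of X) :=
  (alternatingFaceMapComplex (ModuleCat.{0} ℚ)).mapIso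
    (Functor.isoWhiskerLeft (TopCat.toSSet.obj (TopCat.of X)) stFreeIso.symm)

open CategoryTheory AlgebraicTopology in
def stHomIso (X : Type) [TopologicalSpace X] (i : ℕ) :
    singularHomology X i ≅ ((singularHomologyFunctor (ModuleCat.{0} ℚ) i).obj (ModuleCat.of ℚ ℚ)).obj (TopCat.of X) :=
  (HomologicalComplex.homologyFunctor _ _ i).mapIso (stChainIso X)

open CategoryTheory AlgebraicTopology in
def stHtpyIso (X Y : Type) [TopologicalSpace X] [TopologicalSpace Y] (f : C(X, Y)) (g : C(Y, X))
    (h₁ : (g.comp f).Homotopy (ContinuousMap.id X)) (h₂ : f.comp g = ContinuousMap.id Y) (i : ℕ) :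
    ((singularHomologyFunctor (ModuleCat.{0} ℚ) i).obj (ModuleCat.of ℚ ℚ)).obj (TopCat.of X) ≅
    ((singularHomologyFunctor (ModuleCat.{0} ℚ) i).obj (ModuleCat.of ℚ ℚ)).obj (TopCat.of Y) where
  hom := ((singularHomologyFunctor (ModuleCat.{0} ℚ) i).obj (ModuleCat.of ℚ ℚ)).map (TopCat.ofHom f)
  inv := ((singularHomologyFunctor (ModuleCat.{0} ℚ) i).obj (ModuleCat.of ℚ ℚ)).map (TopCat.ofHom g)
  hom_inv_id := by
    rw [← Functor.map_comp]
    have := TopCat.Homotopy.congr_homologyMap_singularChainComplexFunctor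
      (f := TopCat.ofHom f ≫ TopCat.ofHom g) (g := 𝟙 (TopCat.of X)) h₁ (ModuleCat.of ℚ ℚ) i
    refine Eq.trans this ?_
    exact ((singularHomologyFunctor (ModuleCat.{0} ℚ) i).obj (ModuleCat.of ℚ ℚ)).map_id _
  inv_hom_id := by
    rw [← Functor.map_comp, ← TopCat.ofHom_comp, h₂]
    exact ((singularHomologyFunctor (ModuleCat.{0} ℚ) i).obj (ModuleCat.of ℚ ℚ)).map_id _

lemma st_betti (X : Type) [TopologicalSpace X] (f : C(X, Bool)) (g : C(Bool, X))
    (h₁ : (g.comp f).Homotopy (ContinuousMap.id X)) (h₂ : f.comp g = ContinuousMap.id Bool) :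
    bettiNumber X 0 = 2 ∧ bettiNumber X 1 = 0 := by
  constructor
  · have e := (stHomIso X 0 ≪≫ stHtpyIso X Bool f g h₁ h₂ 0 ≪≫
      AlgebraicTopology.singularHomologyFunctorZeroOfTotallyDisconnectedSpace _ (ModuleCat.of ℚ ℚ)
        (TopCat.of Bool) ≪≫ stFreeIso.app Bool).toLinearEquiv
    unfold bettiNumber
    rw [e.finrank_eq]
    exact (Module.finrank_finsupp_self ℚ (ι := Bool)).trans (by simp)
  · have e := (stHomIso X 1 ≪≫ stHtpyIso X Bool f g h₁ h₂ 1)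
    have hz := (AlgebraicTopology.isZero_singularHomologyFunctor_of_totallyDisconnectedSpace
      (ModuleCat.{0} ℚ) 1 (ModuleCat.of ℚ ℚ) (TopCat.of Bool) one_ne_zero).of_iso e
    have := ModuleCat.subsingleton_of_isZero hz
    unfold bettiNumber
    exact Module.finrank_zero_of_subsingleton

lemma st_comp (S : Set (ℂ × ℂ × ℂ)) (f : ℂ × ℂ × ℂ → ℂ) (v₁ v₂ : ℂ) (hv : v₁ ≠ v₂)
    (hf : Continuous f) (hS : ∀ x ∈ S, f x = v₁ ∨ f x = v₂)
    (Φ : ℂ × ℂ × ℂ → ℂ) (hΦ : ContDiff ℝ (⊤ : ℕ∞) Φ)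
    (Ψ : ℂ → ℂ × ℂ × ℂ) (hΨ : ContDiff ℝ (⊤ : ℕ∞) Ψ) (hΨS : ∀ w, Ψ w ∈ S)
    (hfΨ : ∀ w, f (Ψ w) = v₁) (hΦΨ : ∀ w, Φ (Ψ w) = w)
    (hΨΦ : ∀ x ∈ S, f x = v₁ → Ψ (Φ x) = x) :
    (S ∩ f ⁻¹' {v₁}).Nonempty ∧
    (∀ x ∈ S ∩ f ⁻¹' {v₁}, connectedComponentIn S x = S ∩ f ⁻¹' {v₁}) ∧
    DiffeoEquiv (S ∩ f ⁻¹' {v₁}) (Set.univ : Set ℂ) := by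
  refine ⟨⟨Ψ 0, hΨS 0, hfΨ 0⟩, ?_, Φ, Ψ, hΦ.contDiffOn, hΨ.contDiffOn, fun _ _ => mem_univ _,
    fun w _ => ⟨hΨS w, hfΨ w⟩, fun x hx => hΨΦ x hx.1 hx.2, fun w _ => hΦΨ w⟩
  intro x hx
  apply Subset.antisymm
  · intro y hy
    refine ⟨connectedComponentIn_subset _ _ hy, ?_⟩
    have hc : IsPreconnected (f '' connectedComponentIn S x) :=
      isPreconnected_connectedComponentIn.image f hf.continuousOn
    have hsub : f '' connectedComponentIn S x ⊆ {v₁, v₂} := by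
      rintro _ ⟨z, hz, rfl⟩
      exact hS z (connectedComponentIn_subset _ _ hz)
    have hss : (f '' connectedComponentIn S x).Subsingleton := by
      have hfin : (f '' connectedComponentIn S x).Finite := (Set.toFinite {v₁, v₂}).subset hsub
      exact hfin.countable.isTotallyDisconnected _ subset_rfl hc
    have := hss (mem_image_of_mem f hy) (mem_image_of_mem f (mem_connectedComponentIn hx.1))
    exact this.trans hx.2
  · have : IsPreconnected (S ∩ f ⁻¹' {v₁}) := by
      have h : S ∩ f ⁻¹' {v₁} = range Ψ := by
        apply Subset.antisymm
        · intro y hy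
          exact ⟨Φ y, hΨΦ y hy.1 hy.2⟩
        · rintro _ ⟨w, rfl⟩
          exact ⟨hΨS w, hfΨ w⟩
      rw [h]
      exact isPreconnected_range hΨ.continuous
    exact this.subset_connectedComponentIn hx inter_subset_left

lemma st_gen (S : Set (ℂ × ℂ × ℂ)) (f : ℂ × ℂ × ℂ → ℂ) (v₁ v₂ : ℂ) (hv : v₁ ≠ v₂)
    (hf : Continuous f) (hS : ∀ x ∈ S, f x = v₁ ∨ f x = v₂)
    (Φ : ℂ × ℂ × ℂ → ℂ) (hΦ : ContDiff ℝ (⊤ : ℕ∞) Φ)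
    (Ψ : ℂ → ℂ → ℂ × ℂ × ℂ) (hΨ : ∀ v, ContDiff ℝ (⊤ : ℕ∞) (Ψ v))
    (hΨS₁ : ∀ w, Ψ v₁ w ∈ S) (hΨS₂ : ∀ w, Ψ v₂ w ∈ S)
    (hfΨ : ∀ v w, f (Ψ v w) = v) (hΦΨ : ∀ v w, Φ (Ψ v w) = w)
    (hΨΦ : ∀ x ∈ S, Ψ (f x) (Φ x) = x) :
    (∃ C₁ C₂ : Set (ℂ × ℂ × ℂ),
        C₁ ∪ C₂ = S ∧ Disjoint C₁ C₂ ∧ C₁.Nonempty ∧ C₂.Nonempty ∧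
        (∀ x ∈ C₁, connectedComponentIn S x = C₁) ∧
        (∀ x ∈ C₂, connectedComponentIn S x = C₂) ∧
        DiffeoEquiv C₁ (Set.univ : Set ℂ) ∧ DiffeoEquiv C₂ (Set.univ : Set ℂ)) ∧
    bettiNumber ↥S 0 = 2 ∧ bettiNumber ↥S 1 = 0 := by
  constructor
  · obtain ⟨a1, a2, a3⟩ := st_comp S f v₁ v₂ hv hf hS Φ hΦ (Ψ v₁) (hΨ v₁) hΨS₁ (hfΨ v₁) (hΦΨ v₁)
      (fun x hx h => by rw [← h]; exact hΨΦ x hx)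
    obtain ⟨b1, b2, b3⟩ := st_comp S f v₂ v₁ hv.symm hf (fun x hx => (hS x hx).symm) Φ hΦ (Ψ v₂)
      (hΨ v₂) hΨS₂ (hfΨ v₂) (hΦΨ v₂)
      (fun x hx h => by rw [← h]; exact hΨΦ x hx)
    refine ⟨_, _, ?_, ?_, a1, b1, a2, b2, a3, b3⟩
    · ext x
      constructor
      · rintro (h | h) <;> exact h.1
      · intro h
        exact (hS x h).imp (fun h' => ⟨h, h'⟩) (fun h' => ⟨h, h'⟩)
    · rw [Set.disjoint_left]
      intro x h1 h2
      exact hv (h1.2.symm.trans h2.2)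
  · classical
    let val : Bool → ℂ := fun b => if b then v₁ else v₂
    have hΨS : ∀ b w, Ψ (val b) w ∈ S := by
      intro b w; cases b
      · exact hΨS₂ w
      · exact hΨS₁ w
    let ff : S → Bool := fun x => decide (f x.1 = v₁)
    have hval : ∀ x : S, val (ff x) = f x.1 := by
      intro x
      rcases hS x.1 x.2 with h | h
      · simp [val, ff, h]
      · simp [val, ff, h, hv.symm]
    have hffv : ∀ b w, ff ⟨Ψ (val b) w, hΨS b w⟩ = b := by
      intro b w
      cases b <;> simp [ff, hfΨ, val, hv.symm]
    have hff : Continuous ff := by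
      rw [continuous_bool_rng true]
      have hc : Continuous fun x : S => f x.1 := hf.comp continuous_subtype_val
      refine ⟨?_, ?_⟩
      · have : ff ⁻¹' {true} = (fun x : S => f x.1) ⁻¹' {v₁} := by ext x; simp [ff]
        rw [this]; exact isClosed_singleton.preimage hc
      · have : ff ⁻¹' {true} = ((fun x : S => f x.1) ⁻¹' {v₂})ᶜ := by
          ext x
          rcases hS x.1 x.2 with h | h
          · simp [ff, h, hv]
          · simp [ff, h, hv.symm]
        rw [this]; exact (isClosed_singleton.preimage hc).isOpen_compl
    have hΨc : ∀ b, Continuous (Ψ (val b)) := fun b => (hΨ (val b)).continuous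
    have hH : Continuous fun p : Bool × ℂ => (⟨Ψ (val p.1) p.2, hΨS p.1 p.2⟩ : S) := by
      apply Continuous.subtype_mk
      rw [continuous_prod_of_discrete_left]
      exact fun b => hΨc b
    refine st_betti S ⟨ff, hff⟩ ⟨fun b => ⟨Ψ (val b) 0, hΨS b 0⟩, continuous_of_discreteTopology⟩
      ⟨⟨fun p => ⟨Ψ (val (ff p.2)) ((p.1 : ℝ) * Φ p.2.1), hΨS _ _⟩, ?_⟩, ?_, ?_⟩ ?_
    · have : Continuous fun p : unitInterval × S => ((ff p.2, ((p.1 : ℝ) : ℂ) * Φ p.2.1) : Bool × ℂ) := by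
        have := hΦ.continuous
        fun_prop
      exact hH.comp this
    · intro x
      simp
    · intro x
      apply Subtype.ext
      simp [hval, hΨΦ x.1 x.2]
    · ext b
      exact hffv b 0

lemma st_fibre (t : ℂ × ℂ) (h1 : t.1 ≠ 1) (h2 : 1 + t.2 ≠ 0)
    (h3 : 1 + 4 * t.1 * (t.1 - 1) * (1 + t.2) ≠ 0) (F : ℂ × ℂ × ℂ → ℂ × ℂ)
    (hF : F = fun q => (q.1, ((q.1 - 1) * (q.1 * q.2.2 + q.2.1 ^ 2) + 1) *
      (q.1 * (q.1 * q.2.2 + q.2.1 ^ 2) - 1))) :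
    (∃ C₁ C₂ : Set (ℂ × ℂ × ℂ),
        C₁ ∪ C₂ = F ⁻¹' {t} ∧ Disjoint C₁ C₂ ∧ C₁.Nonempty ∧ C₂.Nonempty ∧
        (∀ x ∈ C₁, connectedComponentIn (F ⁻¹' {t}) x = C₁) ∧
        (∀ x ∈ C₂, connectedComponentIn (F ⁻¹' {t}) x = C₂) ∧
        DiffeoEquiv C₁ (Set.univ : Set ℂ) ∧ DiffeoEquiv C₂ (Set.univ : Set ℂ)) ∧
    bettiNumber ↥(F ⁻¹' {t}) 0 = 2 ∧ bettiNumber ↥(F ⁻¹' {t}) 1 = 0 := by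
  obtain ⟨a, c⟩ := t
  dsimp only at h1 h2 h3
  have hmem : ∀ q : ℂ × ℂ × ℂ, q ∈ F ⁻¹' {(a, c)} ↔ q.1 = a ∧
      a * (a - 1) * (a * q.2.2 + q.2.1 ^ 2) ^ 2 + (a * q.2.2 + q.2.1 ^ 2) - 1 = c := by
    intro q
    rw [hF]
    simp only [mem_preimage, mem_singleton_iff, Prod.mk.injEq]
    constructor
    · rintro ⟨rfl, h⟩; exact ⟨rfl, by rw [← h]; ring⟩
    · rintro ⟨rfl, h⟩; exact ⟨rfl, by rw [← h]; ring⟩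
  by_cases ha : a = 0
  · subst ha
    obtain ⟨s, hs⟩ := IsAlgClosed.exists_pow_nat_eq (1 + c) (n := 2) (by norm_num)
    have hs0 : s ≠ 0 := by rintro rfl; apply h2; rw [← hs]; ring
    refine st_gen _ (fun q => q.2.1) s (-s) ?_ (by fun_prop) ?_ (fun q => q.2.2) (by fun_prop)
      (fun v w => (0, v, w)) (fun v => by fun_prop) ?_ ?_ (fun _ _ => rfl) (fun _ _ => rfl) ?_
    · intro h
      apply hs0
      linear_combination h / 2
    · intro x hx
      rw [hmem] at hx
      apply sq_eq_sq_iff_eq_or_eq_neg.mp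
      linear_combination hx.2 - hs
    · intro w; rw [hmem]; exact ⟨rfl, by linear_combination hs⟩
    · intro w; rw [hmem]; exact ⟨rfl, by linear_combination hs⟩
    · intro x hx
      rw [hmem] at hx
      obtain ⟨x, y, z⟩ := x
      simp only [Prod.mk.injEq, and_true]
      exact hx.1.symm
  · obtain ⟨d, hd⟩ := IsAlgClosed.exists_pow_nat_eq (1 + 4 * a * (a - 1) * (1 + c)) (n := 2)
      (by norm_num)
    have hd0 : d ≠ 0 := by rintro rfl; apply h3; rw [← hd]; ring
    have ha1 : a - 1 ≠ 0 := sub_ne_zero.mpr h1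
    have key : ∀ u : ℂ, a * (a - 1) * u ^ 2 + u - 1 = c ↔
        u = (-1 + d) / (2 * a * (a - 1)) ∨ u = (-1 - d) / (2 * a * (a - 1)) := by
      intro u
      have hne : 2 * a * (a - 1) ≠ 0 := by simp [ha, ha1]
      rw [eq_div_iff hne, eq_div_iff hne]
      have : u * (2 * a * (a - 1)) = -1 + d ∨ u * (2 * a * (a - 1)) = -1 - d ↔
          (2 * a * (a - 1) * u + 1) ^ 2 = d ^ 2 := by
        rw [sq_eq_sq_iff_eq_or_eq_neg]
        refine or_congr ⟨fun h => ?_, fun h => ?_⟩ ⟨fun h => ?_, fun h => ?_⟩ <;>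
          linear_combination h
      rw [this, hd]
      constructor
      · intro h
        linear_combination 4 * a * (a - 1) * h
      · intro h
        have : 4 * a * (a - 1) ≠ 0 := by simp [ha, ha1]
        apply mul_left_cancel₀ this
        linear_combination h
    have hz : ∀ v w : ℂ, a * ((v - w ^ 2) / a) + w ^ 2 = v := by
      intro v w; field_simp; ring
    refine st_gen _ (fun q => a * q.2.2 + q.2.1 ^ 2) ((-1 + d) / (2 * a * (a - 1)))
      ((-1 - d) / (2 * a * (a - 1))) ?_ (by fun_prop) ?_ (fun q => q.2.1) (by fun_prop)
      (fun v w => (a, w, (v - w ^ 2) / a)) (fun v => by fun_prop) ?_ ?_ ?_ (fun _ _ => rfl) ?_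
    · intro h
      field_simp at h
      apply hd0
      linear_combination h / 2
    · intro x hx
      rw [hmem] at hx
      exact (key _).1 hx.2
    · intro w; rw [hmem]; refine ⟨rfl, ?_⟩
      dsimp only
      rw [hz, key]; exact Or.inl rfl
    · intro w; rw [hmem]; refine ⟨rfl, ?_⟩
      dsimp only
      rw [hz, key]; exact Or.inr rfl
    · intro v w; exact hz v w
    · intro x hx
      rw [hmem] at hx
      obtain ⟨x, y, z⟩ := x
      simp only [Prod.mk.injEq]
      refine ⟨hx.1.symm, trivial, ?_⟩
      field_simp; ring

lemma st_nontriv (F : ℂ × ℂ × ℂ → ℂ × ℂ)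
    (hF : F = fun q => (q.1, ((q.1 - 1) * (q.1 * q.2.2 + q.2.1 ^ 2) + 1) *
      (q.1 * (q.1 * q.2.2 + q.2.1 ^ 2) - 1))) :
    ¬ ∃ D : Set (ℂ × ℂ), IsOpen D ∧ ((0, 0) : ℂ × ℂ) ∈ D ∧
      ∃ (Φ : ℂ × ℂ × ℂ → (ℂ × ℂ) × (ℂ × ℂ × ℂ))
        (Ψ : (ℂ × ℂ) × (ℂ × ℂ × ℂ) → ℂ × ℂ × ℂ),
        IsHomeoOn Φ Ψ (F ⁻¹' D) (D ×ˢ (F ⁻¹' {((0, 0) : ℂ × ℂ)})) ∧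
        ∀ x ∈ F ⁻¹' D, (Φ x).1 = F x := by
  rintro ⟨D, hDo, hD0, Φ, Ψ, ⟨hΦc, hΨc, hΦm, hΨm, hl, hr⟩, hpr⟩
  have hF0 : ∀ q : ℂ × ℂ × ℂ, F q = (0, 0) ↔ q.1 = 0 ∧ (q.2.1 = 1 ∨ q.2.1 = -1) := by
    intro q
    rw [hF]
    simp only [Prod.mk.injEq]
    constructor
    · rintro ⟨h, h'⟩
      refine ⟨h, sq_eq_one_iff.mp ?_⟩
      rw [h] at h'
      linear_combination h'
    · rintro ⟨h, h' | h'⟩ <;> simp [h, h']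
  have hFc : Continuous F := by rw [hF]; fun_prop
  have hFo : IsOpen (F ⁻¹' D) := hDo.preimage hFc
  -- connected subsets of the zero fibre have constant second coordinate
  have hconst : ∀ A : Set (ℂ × ℂ × ℂ), IsPreconnected A → A ⊆ F ⁻¹' {(0, 0)} →
      ∀ x ∈ A, ∀ y ∈ A, x.2.1 = y.2.1 := by
    intro A hA hAS x hx y hy
    have hc : IsPreconnected ((fun q : ℂ × ℂ × ℂ => q.2.1) '' A) :=
      hA.image _ (by fun_prop)
    have hsub : (fun q : ℂ × ℂ × ℂ => q.2.1) '' A ⊆ {1, -1} := by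
      rintro _ ⟨z, hz, rfl⟩
      exact ((hF0 z).1 (hAS hz)).2
    have hfin := (Set.toFinite {(1 : ℂ), -1}).subset hsub
    exact hfin.countable.isTotallyDisconnected _ subset_rfl hc
      (mem_image_of_mem _ hx) (mem_image_of_mem _ hy)
  -- the curves
  let P : ℂ → ℂ → ℂ × ℂ × ℂ := fun e a => (a, e, 1 / (1 - a))
  have hPF : ∀ e a : ℂ, e ^ 2 = 1 → a ≠ 1 → F (P e a) = (a, 0) := by
    intro e a he ha
    have : 1 - a ≠ 0 := sub_ne_zero.mpr (Ne.symm ha)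
    rw [hF]
    simp only [P, he, Prod.mk.injEq, true_and]
    have : a * (1 / (1 - a)) + 1 = 1 / (1 - a) := by field_simp; ring
    rw [this]
    have : (a - 1) * (1 / (1 - a)) + 1 = 0 := by field_simp; ring
    rw [this]; ring
  have hP0 : ∀ e : ℂ, e ^ 2 = 1 → P e 0 ∈ F ⁻¹' D := by
    intro e he
    show F _ ∈ D
    rw [hPF e 0 he zero_ne_one]; exact hD0
  have hPc : ∀ e : ℂ, ContinuousAt (P e) 0 := by
    intro e
    have : ContinuousAt (fun a : ℂ => 1 / (1 - a)) 0 := by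
      apply ContinuousAt.div <;> [fun_prop; fun_prop; simp]
    exact continuousAt_id.prodMk (continuousAt_const.prodMk this)
  have hG : ∀ e : ℂ, e ^ 2 = 1 → ContinuousAt (fun a => (Φ (P e a)).2.2.1) 0 := by
    intro e he
    have h1 : ContinuousAt Φ (P e 0) := hΦc.continuousAt (hFo.mem_nhds (hP0 e he))
    have h2 : ContinuousAt (fun a => Φ (P e a)) 0 := ContinuousAt.comp (f := P e) h1 (hPc e)
    exact h2.snd.snd.fst
  have hev : ∀ᶠ a : ℂ in 𝓝[≠] 0, (a, (0 : ℂ)) ∈ D ∧ a ≠ 1 ∧ a ≠ 0 := by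
    have h1 : ∀ᶠ a : ℂ in 𝓝 0, (a, (0 : ℂ)) ∈ D :=
      (Continuous.prodMk_left (0 : ℂ)).continuousAt.eventually_mem (hDo.mem_nhds hD0)
    have h2 : ∀ᶠ a : ℂ in 𝓝 0, a ≠ 1 := isOpen_ne.mem_nhds zero_ne_one
    filter_upwards [h1.filter_mono nhdsWithin_le_nhds, h2.filter_mono nhdsWithin_le_nhds,
      self_mem_nhdsWithin] with a h1 h2 h3
    exact ⟨h1, h2, h3⟩
  have hE : ∀ᶠ a : ℂ in 𝓝[≠] 0, (Φ (P 1 a)).2.2.1 = (Φ (P (-1) a)).2.2.1 := by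
    filter_upwards [hev] with a ⟨haD, ha1, ha0⟩
    have h1a : 1 - a ≠ 0 := sub_ne_zero.mpr (Ne.symm ha1)
    let Q : ℂ → ℂ × ℂ × ℂ := fun w => (a, w, (1 / (1 - a) - w ^ 2) / a)
    have hQF : ∀ w, F (Q w) = (a, 0) := by
      intro w
      rw [hF]
      simp only [Q, Prod.mk.injEq, true_and]
      have : a * ((1 / (1 - a) - w ^ 2) / a) + w ^ 2 = 1 / (1 - a) := by field_simp; ring
      rw [this]
      have : (a - 1) * (1 / (1 - a)) + 1 = 0 := by field_simp; ring
      rw [this]; ring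
    have hQD : ∀ w, Q w ∈ F ⁻¹' D := fun w => by
      show F _ ∈ D
      rw [hQF]; exact haD
    have hPQ : ∀ e : ℂ, e ^ 2 = 1 → P e a = Q e := by
      intro e he
      simp only [P, Q, he, Prod.mk.injEq, true_and]
      field_simp; ring
    have hQc : Continuous Q := by fun_prop
    have hc : ContinuousOn (fun w => (Φ (Q w)).2) univ :=
      (hΦc.comp hQc.continuousOn (fun w _ => hQD w)).snd
    have := hconst _ (isPreconnected_univ.image _ hc) (by
      rintro _ ⟨w, -, rfl⟩
      exact (hΦm (hQD w)).2) (Φ (Q 1)).2 ⟨1, mem_univ _, rfl⟩ (Φ (Q (-1))).2 ⟨-1, mem_univ _, rfl⟩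
    rw [hPQ 1 (by norm_num), hPQ (-1) (by norm_num)]
    exact this
  have hlim : (Φ (P 1 0)).2.2.1 = (Φ (P (-1) 0)).2.2.1 := by
    have t1 := (hG 1 (by norm_num)).tendsto.mono_left (nhdsWithin_le_nhds (s := {0}ᶜ))
    have t2 := (hG (-1) (by norm_num)).tendsto.mono_left (nhdsWithin_le_nhds (s := {0}ᶜ))
    exact tendsto_nhds_unique (t1.congr' hE) t2
  -- pull back
  set s := (Φ (P (-1) 0)).2.2.1 with hs
  have hsv : s = 1 ∨ s = -1 := ((hF0 _).1 (hΦm (hP0 (-1) (by norm_num))).2).2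
  let R : ℂ → ℂ × ℂ × ℂ := fun w => Ψ ((0, 0), (0, s, w))
  have hRm : ∀ w, (((0, 0), (0, s, w)) : (ℂ × ℂ) × (ℂ × ℂ × ℂ)) ∈
      D ×ˢ (F ⁻¹' {((0, 0) : ℂ × ℂ)}) := fun w => ⟨hD0, (hF0 _).2 ⟨rfl, hsv⟩⟩
  have hRc : ContinuousOn R univ :=
    hΨc.comp (f := fun w : ℂ => (((0, 0), (0, s, w)) : (ℂ × ℂ) × (ℂ × ℂ × ℂ)))
      (by fun_prop) (fun w _ => hRm w)
  have hRF : ∀ w, F (R w) = (0, 0) := by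
    intro w
    rw [← hpr _ (hΨm (hRm w)), hr (hRm w)]
  have hPR : ∀ e : ℂ, e ^ 2 = 1 → (Φ (P e 0)).2.2.1 = s → ∃ w, R w = P e 0 := by
    intro e he h
    refine ⟨(Φ (P e 0)).2.2.2, ?_⟩
    have : (((0, 0), (0, s, (Φ (P e 0)).2.2.2)) : (ℂ × ℂ) × (ℂ × ℂ × ℂ)) = Φ (P e 0) := by
      have a1 := hpr _ (hP0 e he)
      rw [hPF e 0 he zero_ne_one] at a1
      have a2 := ((hF0 _).1 (hΦm (hP0 e he)).2).1
      exact Prod.ext a1.symm (Prod.ext a2.symm (Prod.ext h.symm rfl))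
    show Ψ _ = _
    rw [this]
    exact hl (hP0 e he)
  obtain ⟨w1, hw1⟩ := hPR 1 (by norm_num) hlim
  obtain ⟨w2, hw2⟩ := hPR (-1) (by norm_num) rfl
  have := hconst _ (isPreconnected_univ.image _ hRc) (by
    rintro _ ⟨w, -, rfl⟩
    exact hRF w) (P 1 0) ⟨w1, mem_univ _, hw1⟩ (P (-1) 0) ⟨w2, mem_univ _, hw2⟩
  simp only [P] at this
  norm_num at this

/-- For `F(x,y,z) = (x, [(x−1)(xz+y²)+1]·[x(xz+y²)−1])`, all fibres
over a neighborhood `U` of `(0,0)` are diffeomorphic to `ℂ ⊔ ℂ` (two connected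
components, each diffeomorphic to `ℂ`, with `b₀ = 2` and `b₁ = 0` constant on `U`), yet
`F` admits no topological trivialization over any neighborhood of `(0,0)`: `(0,0)` is a
bifurcation value of `F` although the Betti numbers of the fibres are constant near it. -/
theorem statement14 (F : ℂ × ℂ × ℂ → ℂ × ℂ)
    (hF : F = fun q => (q.1, ((q.1 - 1) * (q.1 * q.2.2 + q.2.1 ^ 2) + 1) *
      (q.1 * (q.1 * q.2.2 + q.2.1 ^ 2) - 1))) :
    (∃ U : Set (ℂ × ℂ), IsOpen U ∧ ((0, 0) : ℂ × ℂ) ∈ U ∧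
      (∀ t ∈ U, ∃ C₁ C₂ : Set (ℂ × ℂ × ℂ),
        C₁ ∪ C₂ = F ⁻¹' {t} ∧ Disjoint C₁ C₂ ∧ C₁.Nonempty ∧ C₂.Nonempty ∧
        (∀ x ∈ C₁, connectedComponentIn (F ⁻¹' {t}) x = C₁) ∧
        (∀ x ∈ C₂, connectedComponentIn (F ⁻¹' {t}) x = C₂) ∧
        DiffeoEquiv C₁ (Set.univ : Set ℂ) ∧ DiffeoEquiv C₂ (Set.univ : Set ℂ)) ∧
      (∀ t ∈ U, bettiNumber ↥(F ⁻¹' {t}) 0 = 2 ∧ bettiNumber ↥(F ⁻¹' {t}) 1 = 0)) ∧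
    ¬ ∃ D : Set (ℂ × ℂ), IsOpen D ∧ ((0, 0) : ℂ × ℂ) ∈ D ∧
      ∃ (Φ : ℂ × ℂ × ℂ → (ℂ × ℂ) × (ℂ × ℂ × ℂ))
        (Ψ : (ℂ × ℂ) × (ℂ × ℂ × ℂ) → ℂ × ℂ × ℂ),
        IsHomeoOn Φ Ψ (F ⁻¹' D) (D ×ˢ (F ⁻¹' {((0, 0) : ℂ × ℂ)})) ∧
        ∀ x ∈ F ⁻¹' D, (Φ x).1 = F x := by
  refine ⟨⟨{t | t.1 ≠ 1 ∧ 1 + t.2 ≠ 0 ∧ 1 + 4 * t.1 * (t.1 - 1) * (1 + t.2) ≠ 0}, ?_, ?_, ?_, ?_⟩,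
    st_nontriv F hF⟩
  · refine (isOpen_ne_fun (by fun_prop) (by fun_prop)).inter
      ((isOpen_ne_fun (by fun_prop) (by fun_prop)).inter
        (isOpen_ne_fun (by fun_prop) (by fun_prop)))
  · simp
  · rintro t ⟨h1, h2, h3⟩
    exact (st_fibre t h1 h2 h3 F hF).1
  · rintro t ⟨h1, h2, h3⟩
    exact (st_fibre t h1 h2 h3 F hF).2

end
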